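/- Suppose that every submodule of every flat R-module is flat (R has weak dimension at most one), and that every finitely generated submodule of every finitely generated projective R-module is FP-injective. Then for any morphism f : K → X in D(R) between perfect objects such that the induced map H_n(f) : H_n(K) → H_n(X) is zero for every n ∈ ℤ, the morphism f is zero in D(R). -/

import Mathlib

open CategoryTheory Limits Pretriangulated Opposite

universe w u

variable (R : Type u) [CommRing R] [HasDerivedCategory.{w} (ModuleCat.{u} R)]

/-- The derived category `D(R)` of the category of `R`-modules. -/
noncomputable abbrev DR := DerivedCategory (ModuleCat.{u} R)

/-- `R[n]`, the `n`-fold shift of the complex consisting of `R` concentrated in degree `0`. -/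
noncomputable def Rsph (n : ℤ) : DR R :=
  ((DerivedCategory.singleFunctor (ModuleCat.{u} R) 0).obj (ModuleCat.of R R))⟦n⟧

/-- The `n`-th homology module `H_n(X)` of an object `X` of `D(R)` (with homological
indexing, so that `H_n = H^{-n}` cohomologically and `H_n(R[n]) = R`). -/
noncomputable def Hmod (n : ℤ) : DR R ⥤ ModuleCat.{u} R :=
  DerivedCategory.homologyFunctor (ModuleCat.{u} R) (-n)

/-- A class of objects in `D(R)` is *thick-closed* if it is closed under isomorphisms,
shifts, retracts, and completion of distinguished triangles (two-out-of-three). -/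
def IsThickClosed (P : Set (DR R)) : Prop :=
  (∀ X Y : DR R, (X ≅ Y) → X ∈ P → Y ∈ P) ∧
  (∀ (X : DR R) (n : ℤ), X ∈ P → X⟦n⟧ ∈ P) ∧
  (∀ (X Y : DR R) (i : X ⟶ Y) (r : Y ⟶ X), i ≫ r = 𝟙 X → Y ∈ P → X ∈ P) ∧
  (∀ Tr : Triangle (DR R), Tr ∈ (distTriang (DR R)) →
    ((Tr.obj₁ ∈ P → Tr.obj₂ ∈ P → Tr.obj₃ ∈ P) ∧
     (Tr.obj₂ ∈ P → Tr.obj₃ ∈ P → Tr.obj₁ ∈ P) ∧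
     (Tr.obj₁ ∈ P → Tr.obj₃ ∈ P → Tr.obj₂ ∈ P)))

/-- An object of `D(R)` is *perfect* if it lies in the thick subcategory generated by `R`,
i.e. if it belongs to every thick-closed class of objects containing `R[n]` for all `n`. -/
def IsPerfect (X : DR R) : Prop :=
  ∀ P : Set (DR R), (∀ n : ℤ, Rsph R n ∈ P) → IsThickClosed R P → X ∈ P

universe w'

/-- An `R`-module `M` is *FP-injective* if `Ext¹_R(F, M) = 0` for every finitely
presented `R`-module `F`. -/
def FPInjective [HasExt.{w'} (ModuleCat.{u} R)] (M : Type u) [AddCommGroup M]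
    [Module R M] : Prop :=
  ∀ (F : Type u) [AddCommGroup F] [Module R F], Module.FinitePresentation R F →
    Subsingleton (Abelian.Ext (ModuleCat.of R F) (ModuleCat.of R M) 1)

set_option linter.unusedSectionVars false

section Aux

variable {R}

def FGP (M : Type u) [AddCommGroup M] [Module R M] : Prop :=
  Module.Finite R M ∧ Module.Projective R M

lemma FGP.retract {M N : Type u} [AddCommGroup M] [Module R M] [AddCommGroup N] [Module R N]
    (h : FGP (R := R) M) (i : N →ₗ[R] M) (r : M →ₗ[R] N) (hir : r ∘ₗ i = LinearMap.id) :
    FGP (R := R) N := by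
  obtain ⟨h1, h2⟩ := h
  refine ⟨Module.Finite.of_surjective r fun x => ⟨i x, LinearMap.congr_fun hir x⟩,
    Module.Projective.of_split i r hir⟩

/-- Splitting property. -/
def SplitProp (R : Type u) [CommRing R] : Prop :=
  ∀ (Q : Type u) [AddCommGroup Q] [Module R Q], FGP (R := R) Q →
    ∀ N : Submodule R Q, N.FG → ∃ r : Q →ₗ[R] N, r ∘ₗ N.subtype = LinearMap.id

lemma splitProp_of [HasExt.{w'} (ModuleCat.{u} R)]
    (hFP : ∀ (Q : Type u) [AddCommGroup Q] [Module R Q],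
      Module.Finite R Q → Module.Projective R Q →
        ∀ N : Submodule R Q, N.FG → FPInjective R N) : SplitProp R := by
  intro Q _ _ ⟨h1, h2⟩ N hN
  have hfp : Module.FinitePresentation R (Q ⧸ N) := by
    have := Module.finitePresentation_of_projective R Q
    exact Module.finitePresentation_of_surjective N.mkQ N.mkQ_surjective (by simpa using hN)
  have hs := hFP Q h1 h2 N hN (Q ⧸ N) hfp
  let S : ShortComplex (ModuleCat.{u} R) := ShortComplex.mk (ModuleCat.ofHom N.subtype)
    (ModuleCat.ofHom N.mkQ) (by ext x; simp)
  have hS : S.ShortExact := by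
    have : Mono S.f := (ModuleCat.mono_iff_injective _).2 N.injective_subtype
    have : Epi S.g := (ModuleCat.epi_iff_surjective _).2 N.mkQ_surjective
    refine ⟨?_⟩
    rw [ShortComplex.moduleCat_exact_iff]
    intro x hx
    exact ⟨⟨x, by simpa [S] using hx⟩, rfl⟩
  obtain ⟨x₂, hx₂⟩ := Abelian.Ext.contravariant_sequence_exact₁ hS _
    (Abelian.Ext.mk₀ (𝟙 S.X₁)) (n₁ := 1) rfl (hs.elim _ _)
  obtain ⟨r, rfl⟩ := (Abelian.Ext.mk₀_bijective _ _).2 x₂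
  rw [Abelian.Ext.mk₀_comp_mk₀] at hx₂
  have := (Abelian.Ext.mk₀_bijective _ _).1 hx₂
  refine ⟨r.hom, ?_⟩
  ext x
  have := congrArg (fun f => f.hom x) this
  exact congrArg Subtype.val this

lemma FGP.five (hs : SplitProp R) {A₁ A₂ A₃ A₄ A₅ : Type u}
    [AddCommGroup A₁] [Module R A₁] [AddCommGroup A₂] [Module R A₂]
    [AddCommGroup A₃] [Module R A₃] [AddCommGroup A₄] [Module R A₄]
    [AddCommGroup A₅] [Module R A₅]
    (a : A₁ →ₗ[R] A₂) (b : A₂ →ₗ[R] A₃) (c : A₃ →ₗ[R] A₄) (d : A₄ →ₗ[R] A₅)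
    (hab : Function.Exact a b) (hbc : Function.Exact b c) (hcd : Function.Exact c d)
    (h1 : FGP (R := R) A₁) (h2 : FGP (R := R) A₂) (h4 : FGP (R := R) A₄)
    (h5 : FGP (R := R) A₅) : FGP (R := R) A₃ := by
  have := h1.1
  have := h4.1
  have hd : FGP (R := R) (LinearMap.range d) := by
    obtain ⟨r, hr⟩ := hs A₅ h5 (LinearMap.range d) (Module.Finite.iff_fg.1 inferInstance)
    exact h5.retract _ _ hr
  have := hd.2
  obtain ⟨s, hsd⟩ := Module.projective_lifting_property d.rangeRestrict LinearMap.id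
    d.surjective_rangeRestrict
  have hsd' : ∀ y, d (s y) = y := fun y => congrArg Subtype.val (LinearMap.congr_fun hsd y)
  have hker : FGP (R := R) (LinearMap.ker d) := by
    refine h4.retract (LinearMap.ker d).subtype
      (LinearMap.codRestrict (LinearMap.ker d) (LinearMap.id - s ∘ₗ d.rangeRestrict) ?_) ?_
    · intro x
      simp [hsd']
    · ext x
      have : d.rangeRestrict x = 0 := Subtype.ext x.2
      simp [this]
  have hcr : LinearMap.ker d = LinearMap.range c := LinearMap.exact_iff.1 hcd
  rw [hcr] at hker
  have := hker.2
  obtain ⟨t, ht⟩ := Module.projective_lifting_property c.rangeRestrict LinearMap.id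
    c.surjective_rangeRestrict
  have ht' : ∀ y, c (t y) = y := fun y => congrArg Subtype.val (LinearMap.congr_fun ht y)
  obtain ⟨r, hr⟩ := hs A₂ h2 (LinearMap.range a) (Module.Finite.iff_fg.1 inferInstance)
  have hr' : ∀ x, r (a x) = a x := fun x =>
    congrArg Subtype.val (LinearMap.congr_fun hr ⟨a x, x, rfl⟩)
  have hba : LinearMap.ker b = LinearMap.range a := LinearMap.exact_iff.1 hab
  -- range b is a retract of A₂
  have hb : FGP (R := R) (LinearMap.range b) := by
    let q : A₂ →ₗ[R] A₂ := LinearMap.id - (LinearMap.range a).subtype ∘ₗ r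
    have hq : LinearMap.ker b ≤ LinearMap.ker q := by
      rw [hba]
      rintro _ ⟨x, rfl⟩
      simp [q, hr']
    have hbq : ∀ x, b (q x) = b x := by
      intro x
      have : b (r x : A₂) = 0 := by
        rw [← LinearMap.mem_ker, hba]; exact (r x).2
      simp [q, this]
    refine h2.retract (((LinearMap.ker b).liftQ q hq) ∘ₗ
      (b.quotKerEquivRange.symm : _ →ₗ[R] _)) b.rangeRestrict ?_
    ext ⟨_, x, rfl⟩
    have : b.quotKerEquivRange.symm ⟨b x, ⟨x, rfl⟩⟩ = (LinearMap.ker b).mkQ x := by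
      rw [LinearEquiv.symm_apply_eq]; rfl
    simp only [LinearMap.comp_apply, LinearEquiv.coe_coe]
    erw [this]
    simp [hbq]
  have hbc' : LinearMap.ker c = LinearMap.range b := LinearMap.exact_iff.1 hbc
  rw [← hbc'] at hb
  have hprod : FGP (R := R) (LinearMap.ker c × LinearMap.range c) := by
    have := hb.1
    have := hb.2
    have := hker.1
    exact ⟨inferInstance, inferInstance⟩
  refine hprod.retract
    (LinearMap.prod (LinearMap.codRestrict (LinearMap.ker c)
      (LinearMap.id - t ∘ₗ c.rangeRestrict) ?_) c.rangeRestrict)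
    (LinearMap.coprod (LinearMap.ker c).subtype t) ?_
  · intro x
    simp [ht']
  · ext x
    simp

end Aux

section Cplx

variable {C : Type*} [Category C] [Abelian C]

lemma nullhomotopic_of_zero_d {H L : CochainComplex C ℤ} (hd : ∀ i j, H.d i j = 0)
    (hp : ∀ n, Projective (H.X n)) (g : H ⟶ L)
    (hg : ∀ n, HomologicalComplex.homologyMap g n = 0) : Nonempty (Homotopy g 0) := by
  have key : ∀ i j : ℤ, j + 1 = i → ∃ h : H.X i ⟶ L.X j, h ≫ L.d j i = g.f i := by
    intro i j hij
    let S := ShortComplex.mk (L.toCycles j i) (L.homologyπ i) (by simp)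
    have hS : S.Exact := ShortComplex.exact_of_g_is_cokernel _
      (L.homologyIsCokernel j i (by simp; omega))
    have := hp i
    let z : H.X i ⟶ H.cycles i := H.liftCycles (𝟙 _) (i + 1) (by simp) (by simp [hd])
    have hz : (z ≫ HomologicalComplex.cyclesMap g i) ≫ S.g = 0 := by
      have h1 := HomologicalComplex.homologyπ_naturality g i
      rw [hg, comp_zero] at h1
      change (z ≫ HomologicalComplex.cyclesMap g i) ≫ L.homologyπ i = 0
      rw [Category.assoc, ← h1, comp_zero]
    refine ⟨hS.liftFromProjective _ hz, ?_⟩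
    have h2 := hS.liftFromProjective_comp _ hz
    have := congrArg (fun f => f ≫ L.iCycles i) h2
    simpa [S, z] using this
  choose h hh using key
  have : g = Homotopy.nullHomotopicMap' (fun i j hij => h i j hij) := by
    ext n
    rw [Homotopy.nullHomotopicMap'_f (k₂ := n - 1) (k₁ := n) (k₀ := n + 1) (by simp) (by simp)]
    rw [hd, zero_comp, zero_add]
    exact (hh n (n - 1) (by simp)).symm
  rw [this]
  exact ⟨Homotopy.nullHomotopy' _⟩

lemma exists_quasiIso (L : CochainComplex C ℤ) (hp : ∀ n, Projective (L.homology n)) :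
    ∃ (H : CochainComplex C ℤ) (q : H ⟶ L), (∀ i j, H.d i j = 0) ∧ (∀ n, Projective (H.X n)) ∧
      QuasiIso q := by
  have key : ∀ n, ∃ s : L.homology n ⟶ L.cycles n, s ≫ L.homologyπ n = 𝟙 _ := fun n =>
    ⟨Projective.factorThru (𝟙 _) (L.homologyπ n), by simp⟩
  choose s hs using key
  let H : CochainComplex C ℤ :=
    { X := fun n => L.homology n
      d := fun _ _ => 0 }
  have hd : ∀ i j, H.d i j = 0 := fun _ _ => rfl
  let q : H ⟶ L :=
    { f := fun n => s n ≫ L.iCycles n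
      comm' := by intro i j _; simp [hd] }
  refine ⟨H, q, hd, hp, ⟨fun n => ?_⟩⟩
  rw [quasiIsoAt_iff_isIso_homologyMap]
  let z : H.X n ⟶ H.cycles n := H.liftCycles (𝟙 _) (n + 1) (by simp) (by simp [hd])
  have h1 : IsIso (H.iCycles n) := H.isIso_iCycles n (n + 1) (by simp) (hd _ _)
  have h2 : IsIso (H.homologyπ n) := H.isIso_homologyπ (n - 1) n (by simp) (hd _ _)
  have h3 : IsIso z := by
    have : z ≫ H.iCycles n = 𝟙 _ := by simp [z]
    have h4 : IsIso (z ≫ H.iCycles n) := by rw [this]; infer_instance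
    exact IsIso.of_isIso_comp_right z (H.iCycles n)
  have hc : z ≫ HomologicalComplex.cyclesMap q n = s n := by
    rw [← cancel_mono (L.iCycles n)]
    simp [z, q]
  have h5 : (z ≫ H.homologyπ n) ≫ HomologicalComplex.homologyMap q n = 𝟙 _ := by
    rw [Category.assoc, HomologicalComplex.homologyπ_naturality, reassoc_of% hc, hs]
  have h6 : IsIso ((z ≫ H.homologyπ n) ≫ HomologicalComplex.homologyMap q n) := by
    rw [h5]
    exact inferInstanceAs (IsIso (𝟙 (L.homology n)))
  exact IsIso.of_isIso_comp_left (z ≫ H.homologyπ n) _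

lemma ghost_zero [HasDerivedCategory.{w} C] (K X : DerivedCategory C)
    (hp : ∀ n, Projective ((DerivedCategory.homologyFunctor C n).obj K)) (f : K ⟶ X)
    (hf : ∀ n, (DerivedCategory.homologyFunctor C n).map f = 0) : f = 0 := by
  let L := DerivedCategory.Q.objPreimage K
  let eK : DerivedCategory.Q.obj L ≅ K := DerivedCategory.Q.objObjPreimageIso K
  let M := DerivedCategory.Q.objPreimage X
  let eX : DerivedCategory.Q.obj M ≅ X := DerivedCategory.Q.objObjPreimageIso X
  have hL : ∀ n, Projective (L.homology n) := fun n =>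
    Projective.of_iso ((DerivedCategory.homologyFunctor C n).mapIso eK.symm ≪≫
      (DerivedCategory.homologyFunctorFactors C n).app L) (hp n)
  obtain ⟨H, q, hd, hH, hq⟩ := exists_quasiIso L hL
  have hq' := (DerivedCategory.isIso_Q_map_iff_quasiIso _ q).2 hq
  obtain ⟨Y, g, s, hs, hg⟩ := DerivedCategory.left_fac
    (DerivedCategory.Q.map q ≫ eK.hom ≫ f ≫ eX.inv)
  have hg' : DerivedCategory.Q.map g =
      DerivedCategory.Q.map q ≫ eK.hom ≫ f ≫ eX.inv ≫ DerivedCategory.Q.map s := by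
    rw [← cancel_mono (inv (DerivedCategory.Q.map s)), ← hg]
    simp
  have hg0 : ∀ n, HomologicalComplex.homologyMap g n = 0 := by
    intro n
    have h1 := DerivedCategory.homologyFunctorFactors_hom_naturality g n
    rw [hg'] at h1
    simp only [Functor.map_comp, hf, zero_comp, comp_zero] at h1
    exact (cancel_epi ((DerivedCategory.homologyFunctorFactors C n).hom.app H)).1
      (h1.symm.trans comp_zero.symm)
  obtain ⟨h⟩ := nullhomotopic_of_zero_d hd hH g hg0
  have h0 : DerivedCategory.Q.map g = 0 := by
    rw [DerivedCategory.Q_map_eq_of_homotopy _ h, Functor.map_zero]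
  rw [h0, zero_comp] at hg
  rw [← cancel_epi eK.hom, ← cancel_epi (DerivedCategory.Q.map q), ← cancel_mono eX.inv]
  simpa using hg

end Cplx

section Perf

variable {R}

lemma FGP.of_iso {M N : ModuleCat.{u} R} (e : M ≅ N) (h : FGP (R := R) M) :
    FGP (R := R) N :=
  h.retract e.inv.hom e.hom.hom (by
    rw [← ModuleCat.hom_comp, e.inv_hom_id, ModuleCat.hom_id])

/-- Objects whose homology is f.g. projective. -/
def PF (R : Type u) [CommRing R] [HasDerivedCategory.{w} (ModuleCat.{u} R)] : Set (DR R) :=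
  {X | ∀ n : ℤ, FGP (R := R) ((DerivedCategory.homologyFunctor (ModuleCat.{u} R) n).obj X)}

lemma PF_iso {X Y : DR R} (e : X ≅ Y) (h : X ∈ PF R) : Y ∈ PF R := fun n =>
  (h n).of_iso ((DerivedCategory.homologyFunctor (ModuleCat.{u} R) n).mapIso e)

lemma PF_shift {X : DR R} (m : ℤ) (h : X ∈ PF R) : X⟦m⟧ ∈ PF R := fun n =>
  (h (m + n)).of_iso ((((DerivedCategory.homologyFunctor (ModuleCat.{u} R) 0).shiftIso
    m n (m + n) rfl).app X).symm)

lemma PF_tri (hs : SplitProp R) (T : Triangle (DR R)) (hT : T ∈ distTriang (DR R))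
    (h1 : T.obj₁ ∈ PF R) (h3 : T.obj₃ ∈ PF R) : T.obj₂ ∈ PF R := by
  intro n
  have e1 := DerivedCategory.HomologySequence.exact₁ T hT (n - 1) n (by omega)
  have e2 := DerivedCategory.HomologySequence.exact₂ T hT n
  have e3 := DerivedCategory.HomologySequence.exact₃ T hT n (n + 1) (by omega)
  rw [ShortComplex.ShortExact.moduleCat_exact_iff_function_exact] at e1 e2 e3
  exact FGP.five hs _ _ _ _ e1 e2 e3 (h3 _) (h1 _) (h3 _) (h1 _)

lemma PF_thick (hs : SplitProp R) : IsThickClosed R (PF R) := by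
  refine ⟨fun X Y e => PF_iso e, fun X n => PF_shift n, ?_, fun T hT => ⟨?_, ?_, ?_⟩⟩
  · intro X Y i r hir hY n
    refine (hY n).retract ((DerivedCategory.homologyFunctor (ModuleCat.{u} R) n).map i).hom
      ((DerivedCategory.homologyFunctor (ModuleCat.{u} R) n).map r).hom ?_
    rw [← ModuleCat.hom_comp, ← Functor.map_comp, hir, CategoryTheory.Functor.map_id, ModuleCat.hom_id]
  · intro h1 h2
    exact PF_tri hs _ (rot_of_distTriang _ hT) h2 (PF_shift 1 h1)
  · intro h2 h3
    exact PF_tri hs _ (inv_rot_of_distTriang _ hT) (PF_shift (-1) h3) h2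
  · exact PF_tri hs T hT

lemma PF_Rsph (n : ℤ) : Rsph R n ∈ PF R := by
  apply PF_shift
  intro m
  have e := (DerivedCategory.homologyFunctor (ModuleCat.{u} R) m).mapIso
    ((DerivedCategory.singleFunctorIsoCompQ (ModuleCat.{u} R) 0).app (ModuleCat.of R R)) ≪≫
      (DerivedCategory.homologyFunctorFactors (ModuleCat.{u} R) m).app _
  refine FGP.of_iso e.symm ?_
  by_cases hm : m = 0
  · subst hm
    exact FGP.of_iso (HomologicalComplex.singleObjHomologySelfIso (.up ℤ) (0 : ℤ)
      (ModuleCat.of R R)).symm ⟨inferInstanceAs (Module.Finite R R),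
        inferInstanceAs (Module.Projective R R)⟩
  · have hz := HomologicalComplex.isZero_single_obj_homology (.up ℤ) 0 (ModuleCat.of R R) m hm
    have h := ModuleCat.subsingleton_of_isZero hz
    have aux : ∀ (M : ModuleCat.{u} R), Subsingleton M → FGP (R := R) M :=
      fun M _ => ⟨inferInstance, inferInstance⟩
    exact aux _ h

end Perf

/-- if every submodule of every flat `R`-module is flat (`R` has weak
dimension at most one) and every finitely generated submodule of every finitely generated
projective `R`-module is FP-injective, then any morphism between perfect objects of `D(R)`
inducing zero on all homology modules is zero in `D(R)`. -/
theorem freyd_derivedCategory_of_weakDimension_le_one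
    [HasExt.{w'} (ModuleCat.{u} R)]
    (hwd : ∀ (M : Type u) [AddCommGroup M] [Module R M],
      Module.Flat R M → ∀ N : Submodule R M, Module.Flat R N)
    (hFP : ∀ (Q : Type u) [AddCommGroup Q] [Module R Q],
      Module.Finite R Q → Module.Projective R Q →
        ∀ N : Submodule R Q, N.FG → FPInjective R N)
    (K X : DR R) (hK : IsPerfect R K) (hX : IsPerfect R X)
    (f : K ⟶ X) (hf : ∀ n : ℤ, (Hmod R n).map f = 0) :
    f = 0 := by
  have hs : SplitProp R := splitProp_of hFP
  have hK' : K ∈ PF R := hK (PF R) PF_Rsph (PF_thick hs)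
  refine ghost_zero K X (fun n => ?_) f (fun n => ?_)
  · have := (hK' n).2
    exact (IsProjective.iff_projective _).1 this
  · have := hf (-n)
    rwa [Hmod, neg_neg] at this
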